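/- arXiv:2510.26938 — 3 statements merged into one kernel-verified Lean document; each statement's English description precedes it below -/
import Mathlib

section
/- Let G be a connected finite simple graph with at least one edge, and let α denote the number of vertices of odd degree in G. Then the minimum number of exclusive vertex splits required to transform G into a linear forest equals |E(G)| − |V(G)| + max(α/2, 1). -/
open SimpleGraph

/-- Inclusive vertex split of the vertex `u` of `G`.  The resulting graph `G'` lives on
vertex set `Option V`, where `some u` plays the role of the first copy `v₁` of `u` and
`none` plays the role of the second copy `v₂`; every other vertex `x` is represented by
`some x`, with all adjacencies among such vertices unchanged.  The neighborhoods of the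
two copies are contained in `N(u)` and their union is `N(u)`; the two copies are not
adjacent to each other. -/
def IsInclusiveSplit {V : Type} (G : SimpleGraph V) (G' : SimpleGraph (Option V))
    (u : V) : Prop :=
  (∀ x y : V, x ≠ u → y ≠ u → (G'.Adj (some x) (some y) ↔ G.Adj x y)) ∧
  (¬ G'.Adj (some u) none) ∧
  (∀ x : V, G'.Adj (some u) (some x) → G.Adj u x) ∧
  (∀ x : V, G'.Adj none (some x) → G.Adj u x) ∧
  (∀ x : V, G.Adj u x → (G'.Adj (some u) (some x) ∨ G'.Adj none (some x)))

/-- Exclusive vertex split: an inclusive split in which the neighborhoods of the two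
copies are disjoint (they partition `N(u)`). -/
def IsExclusiveSplit {V : Type} (G : SimpleGraph V) (G' : SimpleGraph (Option V))
    (u : V) : Prop :=
  IsInclusiveSplit G G' u ∧
  ∀ x : V, ¬ (G'.Adj (some u) (some x) ∧ G'.Adj none (some x))

/-- `InclReach P k V G` : the graph `G` can be transformed, by a sequence of **at most**
`k` inclusive vertex splits, into a graph satisfying the property `P`. -/
def InclReach (P : (W : Type) → SimpleGraph W → Prop) :
    (k : ℕ) → (V : Type) → SimpleGraph V → Prop
  | 0, V, G => P V G
  | k+1, V, G => P V G ∨ ∃ (u : V) (G' : SimpleGraph (Option V)),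
      IsInclusiveSplit G G' u ∧ InclReach P k (Option V) G'

/-- `ExclReach P k V G` : the graph `G` can be transformed, by a sequence of **at most**
`k` exclusive vertex splits, into a graph satisfying the property `P`. -/
def ExclReach (P : (W : Type) → SimpleGraph W → Prop) :
    (k : ℕ) → (V : Type) → SimpleGraph V → Prop
  | 0, V, G => P V G
  | k+1, V, G => P V G ∨ ∃ (u : V) (G' : SimpleGraph (Option V)),
      IsExclusiveSplit G G' u ∧ ExclReach P k (Option V) G'

/-- The vertex type obtained from `V` after `k` vertex splits. -/
def IterOpt : ℕ → Type → Type
  | 0, V => V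
  | k+1, V => IterOpt k (Option V)

/-- `InclSeq k V G G'` : `G'` is obtained from `G` by a sequence of **exactly** `k`
inclusive vertex splits. -/
def InclSeq : (k : ℕ) → (V : Type) → SimpleGraph V → SimpleGraph (IterOpt k V) → Prop
  | 0, _V, G, G' => G' = G
  | k+1, V, G, G' => ∃ (u : V) (G₁ : SimpleGraph (Option V)),
      IsInclusiveSplit G G₁ u ∧ InclSeq k (Option V) G₁ G'

/-- `ExclSeq k V G G'` : `G'` is obtained from `G` by a sequence of **exactly** `k`
exclusive vertex splits. -/
def ExclSeq : (k : ℕ) → (V : Type) → SimpleGraph V → SimpleGraph (IterOpt k V) → Prop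
  | 0, _V, G, G' => G' = G
  | k+1, V, G, G' => ∃ (u : V) (G₁ : SimpleGraph (Option V)),
      IsExclusiveSplit G G₁ u ∧ ExclSeq k (Option V) G₁ G'

/-- A (single) cycle: a connected graph in which every vertex has degree exactly 2. -/
def IsSingleCycle {W : Type} (G : SimpleGraph W) : Prop :=
  G.Connected ∧ ∀ v : W, (G.neighborSet v).ncard = 2

/-- A cycle graph: a disjoint union of cycles, i.e. every connected component is a cycle. -/
def IsCycleGraph {W : Type} (G : SimpleGraph W) : Prop :=
  ∀ C : G.ConnectedComponent, IsSingleCycle (G.induce C.supp)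

/-- A star: a single central vertex adjacent to all other vertices, with no other edges. -/
def IsStarGraph {W : Type} (G : SimpleGraph W) : Prop :=
  ∃ c : W, ∀ v w : W, G.Adj v w ↔ ((v = c ∧ w ≠ c) ∨ (w = c ∧ v ≠ c))

/-- A constellation: a disjoint union of stars, i.e. every connected component is a star. -/
def IsConstellation {W : Type} (G : SimpleGraph W) : Prop :=
  ∀ C : G.ConnectedComponent, IsStarGraph (G.induce C.supp)

/-- A linear forest: every connected component is a path with at least one edge.
Equivalently (for finite graphs): acyclic, maximum degree at most 2,
and no isolated vertices. -/
def IsLinearForest {W : Type} (G : SimpleGraph W) : Prop :=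
  G.IsAcyclic ∧ (∀ v : W, (G.neighborSet v).ncard ≤ 2) ∧ (∀ v : W, ∃ w, G.Adj v w)

/-- The weight of a set of subgraphs: the sum of the numbers of vertices of its members. -/
noncomputable def wgt {V : Type} {G : SimpleGraph V} (P : Finset G.Subgraph) : ℕ :=
  ∑ H ∈ P, H.verts.ncard

/-- The edge sets of the members of `P` form a partition of the edge set of `G`:
every edge of `G` lies in exactly one member of `P`. -/
def IsEdgeDecomposition {V : Type} {G : SimpleGraph V} (P : Finset G.Subgraph) : Prop :=
  ∀ e ∈ G.edgeSet, ∃! H : G.Subgraph, H ∈ P ∧ e ∈ H.edgeSet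

/-- A star decomposition of `G`: a set of subgraphs of `G`, each of which is a star
(with a nonempty edge set, as parts of a partition are nonempty), whose edge sets
partition `E(G)`. -/
def IsStarDecomposition {V : Type} {G : SimpleGraph V} (P : Finset G.Subgraph) : Prop :=
  (∀ H ∈ P, H.edgeSet.Nonempty ∧ IsStarGraph H.coe) ∧ IsEdgeDecomposition P

/-- A `Γ`-decomposition of `G`, where `Γ` is a family of graphs: a set of subgraphs of
`G`, each isomorphic to a member of `Γ` (with a nonempty edge set, as parts of a
partition are nonempty), whose edge sets partition `E(G)`. -/
def IsGammaDecomposition {V ι : Type} (Γ : ι → (W : Type) × SimpleGraph W)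
    {G : SimpleGraph V} (P : Finset G.Subgraph) : Prop :=
  (∀ H ∈ P, H.edgeSet.Nonempty ∧ ∃ i : ι, Nonempty (H.coe ≃g (Γ i).2)) ∧
  IsEdgeDecomposition P

/-- `G` is a disjoint union of graphs of the family `Γ`: every connected component of
`G` is isomorphic to a member of `Γ`. -/
def IsDisjointUnionOf {V ι : Type} (Γ : ι → (W : Type) × SimpleGraph W)
    (G : SimpleGraph V) : Prop :=
  ∀ C : G.ConnectedComponent, ∃ i : ι, Nonempty ((G.induce C.supp) ≃g (Γ i).2)

/-- The number of neighbors of `v`. -/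
noncomputable def nbrCount {V : Type} (G : SimpleGraph V) (v : V) : ℕ :=
  (G.neighborSet v).ncard

/-- Any vertex of a cycle has two distinct neighbors joined by a walk avoiding it. -/
theorem exists_walk_avoiding_of_isCycle {V : Type} {G : SimpleGraph V} {u : V} {c : G.Walk u u}
    (hc : c.IsCycle) : ∃ a b, a ≠ b ∧ G.Adj u a ∧ G.Adj u b ∧
      ∃ p : G.Walk a b, u ∉ p.support := by
  obtain _ | @⟨_, a, _, ha, q⟩ := c
  · exact absurd rfl hc.ne_nil
  rw [Walk.cons_isCycle_iff] at hc
  have hq : ¬ q.Nil := fun h ↦ ha.ne h.eq.symm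
  refine ⟨a, q.penultimate, ?_, ha, (q.adj_penultimate hq).symm, q.dropLast, ?_⟩
  · intro he
    have hmem := q.mk_penultimate_end_mem_edges hq
    rw [← he, Sym2.eq_swap] at hmem
    exact hc.2 hmem
  · intro hu
    have h := hc.1.support_nodup
    rw [← Walk.dropLast_support_concat, List.nodup_append] at h
    rw [Walk.support_dropLast hq] at hu
    exact h.2.2 u hu u (by simp) rfl

section Counting

theorem degree_eq_nbrCount {V : Type} (G : SimpleGraph V) (v : V) [Fintype (G.neighborSet v)] :
    G.degree v = nbrCount G v := by
  rw [nbrCount, Set.ncard_eq_toFinset_card', Set.toFinset_card, card_neighborSet_eq_degree]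

variable {V : Type} [Fintype V] (G : SimpleGraph V)

theorem sum_nbrCount : ∑ v, nbrCount G v = 2 * G.edgeSet.ncard := by
  classical
  simp only [← degree_eq_nbrCount]
  rw [G.sum_degrees_eq_twice_card_edges, Set.ncard_eq_toFinset_card']
  rfl

theorem sum_nbrCount_mod_two :
    ∑ v, nbrCount G v % 2 = {v : V | Odd (nbrCount G v)}.ncard := by
  classical
  rw [Set.ncard_eq_toFinset_card', Set.toFinset_ofPred, Finset.card_filter]
  refine Finset.sum_congr rfl fun v _ ↦ ?_
  split_ifs with h
  · exact Nat.odd_iff.mp h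
  · exact Nat.even_iff.mp (Nat.not_odd_iff_even.mp h)

theorem even_sum_nbrCount_mod_two : Even (∑ v, nbrCount G v % 2) := by
  have h : Even (∑ v, nbrCount G v) := sum_nbrCount G ▸ even_two_mul _
  rw [Nat.even_iff] at h ⊢
  rwa [← Finset.sum_nat_mod]

variable {G}

theorem nbrCount_pos_iff {v : V} : 0 < nbrCount G v ↔ ∃ w, G.Adj v w :=
  Set.ncard_pos (Set.toFinite _)

/-- Twice the sum of the `⌈d / 2⌉ - 1` over all degrees `d`, when these are positive. -/
theorem two_mul_sum_nbrCount_sub_one_div_two (hpos : ∀ v, 0 < nbrCount G v) :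
    2 * ∑ v, (nbrCount G v - 1) / 2 + 2 * Fintype.card V
      = ∑ v, nbrCount G v + ∑ v, nbrCount G v % 2 := by
  have h : ∀ v, 2 * ((nbrCount G v - 1) / 2) + 2 = nbrCount G v + nbrCount G v % 2 := by
    intro v
    have := hpos v
    omega
  rw [← Finset.sum_add_distrib, ← Finset.sum_congr rfl fun v _ ↦ h v, Finset.sum_add_distrib,
    Finset.mul_sum]
  simp [mul_comm]

/-- A finite forest without isolated vertices has a leaf. -/
theorem exists_nbrCount_eq_one [Nonempty V] (hG : G.IsAcyclic)
    (hpos : ∀ v, 0 < nbrCount G v) : ∃ v, nbrCount G v = 1 := by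
  classical
  obtain ⟨u, v, p, hp, hmax⟩ := Walk.exists_isPath_forall_isPath_length_le_length G
  obtain ⟨w, hw⟩ := nbrCount_pos_iff.mp (hpos u)
  have hsnd : ∀ x, G.Adj u x → x = p.snd := by
    intro x hx
    refine hG.eq_snd_of_adj_start hp hx ?_
    by_contra hs
    have := hmax _ _ _ (hp.cons (h := hx.symm) hs)
    rw [Walk.length_cons] at this
    omega
  refine ⟨u, ?_⟩
  rw [← degree_eq_nbrCount, degree_eq_one_iff_existsUnique_adj]
  exact ⟨w, hw, fun x hx ↦ (hsnd x hx).trans (hsnd w hw).symm⟩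

theorem two_le_sum_nbrCount_mod_two {v : V} (hv : Odd (nbrCount G v)) :
    2 ≤ ∑ v, nbrCount G v % 2 := by
  have h := Finset.single_le_sum (f := fun v ↦ nbrCount G v % 2) (fun _ _ ↦ Nat.zero_le _)
    (Finset.mem_univ v)
  have hv := Nat.odd_iff.mp hv
  have := even_sum_nbrCount_mod_two G
  rw [Nat.even_iff] at this
  omega

/-- In a connected graph with an odd degree and a cycle, some vertex of degree at least three
has two distinct neighbors joined by a walk avoiding it. -/
theorem exists_branching_vertex_on_cycle (hconn : G.Connected) (hcyc : ¬ G.IsAcyclic)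
    {o : V} (ho : Odd (nbrCount G o)) :
    ∃ u a b, 3 ≤ nbrCount G u ∧ a ≠ b ∧ G.Adj u a ∧ G.Adj u b ∧
      ∃ p : G.Walk a b, u ∉ p.support := by
  obtain ⟨v, c, hc⟩ : ∃ (v : V) (c : G.Walk v v), c.IsCycle := by
    simpa [IsAcyclic] using hcyc
  obtain ⟨u, hu, hdeg⟩ : ∃ u ∈ c.support, 3 ≤ nbrCount G u := by
    by_contra! hlt
    have hnbr : ∀ x ∈ c.support, c.toSubgraph.neighborSet x = G.neighborSet x := by
      intro x hx
      refine Set.eq_of_subset_of_ncard_le (c.toSubgraph.neighborSet_subset x) ?_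
      rw [hc.ncard_neighborSet_toSubgraph_eq_two hx]
      exact Nat.le_of_lt_succ (hlt x hx)
    have hclosed : ∀ {x y : V}, G.Walk x y → x ∈ c.support → y ∈ c.support := by
      intro x y q hx
      induction q with
      | nil => exact hx
      | @cons x z _ hxz _ ih =>
        refine ih ?_
        have : z ∈ c.toSubgraph.neighborSet x := (hnbr x hx).symm ▸ hxz
        exact c.mem_verts_toSubgraph.mp (c.toSubgraph.edge_vert this.symm)
    have ho' := hclosed (hconn.preconnected v o).some c.start_mem_support
    rw [nbrCount, ← hnbr o ho', hc.ncard_neighborSet_toSubgraph_eq_two ho'] at ho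
    exact absurd ho (by decide)
  classical
  obtain ⟨a, b, hab, ha, hb, p, hp⟩ := exists_walk_avoiding_of_isCycle (hc.rotate hu)
  exact ⟨u, a, b, hdeg, hab, ha, hb, p, hp⟩

end Counting

section Split

variable {V : Type} {G : SimpleGraph V} {G' : SimpleGraph (Option V)} {u : V}

/-- Prescribing the neighborhood `A` of the new copy determines an exclusive split. -/
theorem exists_isExclusiveSplit {A : Set V} (hA : A ⊆ G.neighborSet u) :
    ∃ G' : SimpleGraph (Option V), IsExclusiveSplit G G' u ∧
      (∀ x, G'.Adj none (some x) ↔ x ∈ A) ∧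
      (∀ x, G'.Adj (some u) (some x) ↔ G.Adj u x ∧ x ∉ A) := by
  let G' : SimpleGraph (Option V) :=
    { Adj := fun p q ↦ match p, q with
        | none, none => False
        | none, some x => x ∈ A
        | some x, none => x ∈ A
        | some x, some y => G.Adj x y ∧ ¬ (x = u ∧ y ∈ A) ∧ ¬ (y = u ∧ x ∈ A)
      symm := ⟨by
        rintro (_ | x) (_ | y) h
        · exact h
        · exact h
        · exact h
        · exact ⟨h.1.symm, h.2.2, h.2.1⟩⟩
      loopless := ⟨by
        rintro (_ | x) h
        · exact h
        · exact h.1.ne rfl⟩ }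
  have hu : u ∉ A := fun h ↦ (hA h).ne rfl
  have hnone : ∀ x, G'.Adj none (some x) ↔ x ∈ A := fun _ ↦ Iff.rfl
  have hsome : ∀ x y, G'.Adj (some x) (some y) ↔
      G.Adj x y ∧ ¬ (x = u ∧ y ∈ A) ∧ ¬ (y = u ∧ x ∈ A) := fun _ _ ↦ Iff.rfl
  have hnu : ¬ G'.Adj (some u) none := fun h ↦ hu h
  have hA' : ∀ x ∈ A, G.Adj u x := fun x hx ↦ hA hx
  clear_value G'
  refine ⟨G', ⟨⟨?_, hnu, ?_, ?_, ?_⟩, ?_⟩, hnone, ?_⟩ <;> grind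

/-- The map collapsing the two copies of the split vertex `u`. -/
def unsplit (u : V) (p : Option V) : V := p.getD u

@[simp] theorem unsplit_none (u : V) : unsplit u none = u := rfl

@[simp] theorem unsplit_some (u x : V) : unsplit u (some x) = x := rfl

namespace IsExclusiveSplit

theorem adj_unsplit (h : IsExclusiveSplit G G' u) {p q : Option V} (hpq : G'.Adj p q) :
    G.Adj (unsplit u p) (unsplit u q) := by
  obtain ⟨⟨h1, h2, h3, h4, h5⟩, h6⟩ := h
  rcases p with _ | x <;> rcases q with _ | y
  · exact absurd rfl hpq.ne
  · exact h4 y hpq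
  · exact (h4 x hpq.symm).symm
  · by_cases hx : x = u
    · subst hx; exact h3 y hpq
    by_cases hy : y = u
    · subst hy; exact (h3 x hpq.symm).symm
    exact (h1 x y hx hy).mp hpq

theorem eq_of_unsplit_eq (h : IsExclusiveSplit G G' u) {p q q' : Option V} (hq : G'.Adj p q)
    (hq' : G'.Adj p q') (he : unsplit u q = unsplit u q') : q = q' := by
  obtain ⟨⟨h1, h2, h3, h4, h5⟩, h6⟩ := h
  rcases q with _ | y <;> rcases q' with _ | z <;> simp only [unsplit_none, unsplit_some] at he
  · rfl
  · subst he
    rcases p with _ | x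
    · exact absurd hq G'.irrefl
    · exact absurd ⟨hq'.symm, hq.symm⟩ (h6 x)
  · subst he
    rcases p with _ | x
    · exact absurd hq' G'.irrefl
    · exact absurd ⟨hq.symm, hq'.symm⟩ (h6 x)
  · rw [he]

theorem eq_of_adj_of_adj (h : IsExclusiveSplit G G' u) {p q p' q' : Option V}
    (hpq : G'.Adj p q) (hpq' : G'.Adj p' q') (hp : unsplit u p = unsplit u p')
    (hq : unsplit u q = unsplit u q') : p = p' ∧ q = q' := by
  have key : ∀ {r s : Option V}, unsplit u r = unsplit u s → unsplit u r ≠ u → r = s := by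
    rintro (_ | x) (_ | y) hrs hr <;> simp_all
  have hne := (h.adj_unsplit hpq).ne
  by_cases hu : unsplit u p = u
  · obtain rfl := key hq fun hu' ↦ hne (hu.trans hu'.symm)
    exact ⟨h.eq_of_unsplit_eq hpq.symm hpq'.symm hp, rfl⟩
  · obtain rfl := key hp hu
    exact ⟨rfl, h.eq_of_unsplit_eq hpq hpq' hq⟩

theorem isAcyclic (h : IsExclusiveSplit G G' u) (hG : G.IsAcyclic) : G'.IsAcyclic := by
  rw [isAcyclic_iff_forall_adj_isBridge] at hG ⊢
  intro p q hpq hreach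
  refine hG (h.adj_unsplit hpq) ?_
  let f : G'.deleteEdges {s(p, q)} →g G.deleteEdges {s(unsplit u p, unsplit u q)} :=
    { toFun := unsplit u
      map_rel' := by
        intro r s hrs
        rw [deleteEdges_adj] at hrs ⊢
        refine ⟨h.adj_unsplit hrs.1, fun he ↦ hrs.2 ?_⟩
        rw [Set.mem_singleton_iff, Sym2.eq_iff] at he ⊢
        rcases he with ⟨h1, h2⟩ | ⟨h1, h2⟩
        · exact .inl (h.eq_of_adj_of_adj hrs.1 hpq h1 h2)
        · exact .inr (h.eq_of_adj_of_adj hrs.1 hpq.symm h1 h2) }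
  exact hreach.map f

theorem nbrCount_some (h : IsExclusiveSplit G G' u) {x : V} (hx : x ≠ u) :
    nbrCount G' (some x) = nbrCount G x := by
  have himage : unsplit u '' G'.neighborSet (some x) = G.neighborSet x := by
    ext y
    constructor
    · rintro ⟨q, hq, rfl⟩
      exact h.adj_unsplit hq
    · intro hy
      by_cases hyu : y = u
      · subst hyu
        rcases h.1.2.2.2.2 x hy.symm with hs | hn
        · exact ⟨some y, hs.symm, rfl⟩
        · exact ⟨none, hn.symm, rfl⟩
      · exact ⟨some y, (h.1.1 x y hx hyu).mpr hy, rfl⟩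
  rw [nbrCount, nbrCount, ← himage, Set.InjOn.ncard_image]
  exact fun q hq q' hq' he ↦ h.eq_of_unsplit_eq hq hq' he

theorem nbrCount_add [Finite V] (h : IsExclusiveSplit G G' u) :
    nbrCount G' (some u) + nbrCount G' none = nbrCount G u := by
  have himage : unsplit u '' (G'.neighborSet (some u) ∪ G'.neighborSet none)
      = G.neighborSet u := by
    ext y
    constructor
    · rintro ⟨q, hq | hq, rfl⟩
      · exact h.adj_unsplit hq
      · exact h.adj_unsplit hq
    · intro hy
      rcases h.1.2.2.2.2 y hy with hs | hn
      · exact ⟨some y, .inl hs, rfl⟩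
      · exact ⟨some y, .inr hn, rfl⟩
  have hmem : ∀ q ∈ G'.neighborSet (some u) ∪ G'.neighborSet none, ∃ y, q = some y := by
    rintro (_ | y) (hq | hq)
    · exact absurd hq h.1.2.1
    · exact absurd hq G'.irrefl
    · exact ⟨y, rfl⟩
    · exact ⟨y, rfl⟩
  rw [nbrCount, nbrCount, nbrCount, ← himage, Set.InjOn.ncard_image, Set.ncard_union_eq]
  · rw [Set.disjoint_left]
    intro q hq hq'
    obtain ⟨y, rfl⟩ := hmem q (.inl hq)
    exact h.2 y ⟨hq, hq'⟩
  · intro q hq q' hq' he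
    obtain ⟨y, rfl⟩ := hmem q hq
    obtain ⟨z, rfl⟩ := hmem q' hq'
    exact congrArg some he

theorem sum_nbrCount_comp [Fintype V] (h : IsExclusiveSplit G G' u) (f : ℕ → ℕ) :
    ∑ p, f (nbrCount G' p) + f (nbrCount G u)
      = ∑ v, f (nbrCount G v) + f (nbrCount G' (some u)) + f (nbrCount G' none) := by
  classical
  rw [Fintype.sum_option, ← Finset.add_sum_erase (f := fun x ↦ f (nbrCount G' (some x))) _ (Finset.mem_univ u),
    ← Finset.add_sum_erase (f := fun v ↦ f (nbrCount G v)) _ (Finset.mem_univ u),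
    Finset.sum_congr rfl fun x hx ↦ by rw [h.nbrCount_some (Finset.ne_of_mem_erase hx)]]
  ring

theorem nbrCount_pos (h : IsExclusiveSplit G G' u) (hpos : ∀ v, 0 < nbrCount G v)
    (hs : 0 < nbrCount G' (some u)) (hn : 0 < nbrCount G' none) (p : Option V) :
    0 < nbrCount G' p := by
  rcases p with _ | x
  · exact hn
  · by_cases hx : x = u
    · exact hx ▸ hs
    · exact h.nbrCount_some hx ▸ hpos x

theorem connected (h : IsExclusiveSplit G G' u) (hG : G.Connected)
    {a b : V} (ha : G'.Adj none (some a)) (hb : G'.Adj (some u) (some b))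
    (p : G.Walk a b) (hp : u ∉ p.support) : G'.Connected := by
  have hlift : ∀ {x y : V} (q : G.Walk x y), u ∉ q.support →
      G'.Reachable (some x) (some y) := by
    intro x y q hq
    induction q with
    | nil => rfl
    | cons hxy q ih =>
      rw [Walk.support_cons, List.mem_cons, not_or] at hq
      refine Reachable.trans (Adj.reachable ?_) (ih hq.2)
      exact (h.1.1 _ _ (Ne.symm hq.1) fun he ↦ hq.2 (he ▸ q.start_mem_support)).mpr hxy
  have hun : G'.Reachable none (some u) :=
    ha.reachable.trans ((hlift p hp).trans hb.symm.reachable)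
  have hu : ∀ y, G.Adj u y → G'.Reachable (some u) (some y) := by
    intro y hy
    rcases h.1.2.2.2.2 y hy with hs | hn
    · exact hs.reachable
    · exact hun.symm.trans hn.reachable
  have hadj : ∀ x y, G.Adj x y → G'.Reachable (some x) (some y) := by
    intro x y hxy
    by_cases hx : x = u
    · exact hx ▸ hu y (hx ▸ hxy)
    by_cases hy : y = u
    · exact hy ▸ (hu x (hy ▸ hxy.symm)).symm
    exact ((h.1.1 x y hx hy).mpr hxy).reachable
  have hwalk : ∀ {x y : V}, G.Walk x y → G'.Reachable (some x) (some y) := by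
    intro x y q
    induction q with
    | nil => rfl
    | cons hxy _ ih => exact (hadj _ _ hxy).trans ih
  rw [connected_iff_exists_forall_reachable]
  refine ⟨some u, ?_⟩
  rintro (_ | x)
  · exact hun.symm
  · exact hwalk (hG.preconnected u x).some

end IsExclusiveSplit

/-- An exclusive split giving the new copy the neighborhood `A`, with the resulting degrees. -/
theorem exists_isExclusiveSplit_nbrCount [Finite V] {A : Set V} (hA : A ⊆ G.neighborSet u) :
    ∃ G' : SimpleGraph (Option V), IsExclusiveSplit G G' u ∧
      (∀ x, G'.Adj none (some x) ↔ x ∈ A) ∧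
      (∀ x, G'.Adj (some u) (some x) ↔ G.Adj u x ∧ x ∉ A) ∧
      nbrCount G' none = A.ncard ∧ nbrCount G' (some u) = nbrCount G u - A.ncard := by
  obtain ⟨G', h, hn, hs⟩ := exists_isExclusiveSplit hA
  have hcard : nbrCount G' none = A.ncard := by
    have : G'.neighborSet none = some '' A := by
      ext q
      rcases q with _ | x
      · simp
      · simpa using hn x
    rw [nbrCount, this, Set.ncard_image_of_injective _ (Option.some_injective V)]
  have := h.nbrCount_add
  exact ⟨G', h, hn, hs, hcard, by omega⟩

end Split

theorem ExclReach.of_prop {P : (W : Type) → SimpleGraph W → Prop} {V : Type} {G : SimpleGraph V}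
    (h : P V G) (k : ℕ) : ExclReach P k V G := by
  cases k with
  | zero => exact h
  | succ k => exact .inl h

theorem IsExclusiveSplit.exclReach_succ {P : (W : Type) → SimpleGraph W → Prop} {V : Type}
    {G : SimpleGraph V} {G' : SimpleGraph (Option V)} {u : V} (h : IsExclusiveSplit G G' u)
    {k : ℕ} (hk : ExclReach P k (Option V) G') : ExclReach P (k + 1) V G :=
  .inr ⟨u, G', h, hk⟩

/-- The lower bound: at least `|E| - |V| + max (α / 2) 1` splits are needed, in the form
given by the handshake lemma. -/
theorem ExclReach.sum_nbrCount_add_le {k : ℕ} {V : Type} [Fintype V] [Nonempty V]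
    {G : SimpleGraph V} (h : ExclReach (fun _ H ↦ IsLinearForest H) k V G) :
    ∑ v, nbrCount G v + max (∑ v, nbrCount G v % 2) 2 ≤ 2 * Fintype.card V + 2 * k := by
  have hforest : ∀ {W : Type} [Fintype W] [Nonempty W] {H : SimpleGraph W},
      IsLinearForest H →
      ∑ v, nbrCount H v + max (∑ v, nbrCount H v % 2) 2 ≤ 2 * Fintype.card W := by
    rintro W _ _ H ⟨hac, hle, hadj⟩
    have hpos : ∀ v, 0 < nbrCount H v := fun v ↦ nbrCount_pos_iff.mpr (hadj v)
    have hzero : ∑ v, (nbrCount H v - 1) / 2 = 0 := by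
      refine Finset.sum_eq_zero fun v _ ↦ ?_
      have : nbrCount H v ≤ 2 := hle v
      omega
    have hsum := two_mul_sum_nbrCount_sub_one_div_two hpos
    obtain ⟨v, hv⟩ := exists_nbrCount_eq_one hac hpos
    have := two_le_sum_nbrCount_mod_two (G := H) (v := v) (hv ▸ odd_one)
    omega
  induction k generalizing V with
  | zero => exact hforest h
  | succ k ih =>
    rcases h with h | ⟨u, G', hs, hk⟩
    · have := hforest h
      omega
    · have := ih hk
      have h1 := hs.sum_nbrCount_comp id
      have h2 := hs.sum_nbrCount_comp (· % 2)
      have h3 := hs.nbrCount_add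
      simp only [id] at h1
      rw [Fintype.card_option] at this
      omega

/-- The upper bound for forests, and for connected graphs with a vertex of odd degree. -/
theorem exclReach_sum_nbrCount_sub_one_div_two {V : Type} [Fintype V] {G : SimpleGraph V}
    (hpos : ∀ v, 0 < nbrCount G v)
    (hG : G.IsAcyclic ∨ G.Connected ∧ ∃ v, Odd (nbrCount G v)) :
    ExclReach (fun _ H ↦ IsLinearForest H) (∑ v, (nbrCount G v - 1) / 2) V G := by
  induction hn : ∑ v, (nbrCount G v - 1) / 2 generalizing V with
  | zero =>
    have hle : ∀ v, nbrCount G v ≤ 2 := by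
      intro v
      have := Finset.sum_eq_zero_iff.mp hn v (Finset.mem_univ v)
      omega
    have hac : G.IsAcyclic := by
      by_contra hcyc
      obtain ⟨hconn, o, ho⟩ := hG.resolve_left hcyc
      obtain ⟨u, _, _, hu, _⟩ := exists_branching_vertex_on_cycle hconn hcyc ho
      exact absurd (hle u) (by omega)
    exact ⟨hac, hle, fun v ↦ nbrCount_pos_iff.mp (hpos v)⟩
  | succ n ih =>
    have hstep : ∀ {u : V} {G' : SimpleGraph (Option V)}, IsExclusiveSplit G G' u →
        3 ≤ nbrCount G u → nbrCount G' none = 2 → nbrCount G' (some u) = nbrCount G u - 2 →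
        (G'.IsAcyclic ∨ G'.Connected ∧ ∃ v, Odd (nbrCount G v)) →
        ExclReach (fun _ H ↦ IsLinearForest H) (n + 1) V G := by
      intro u G' h hu hnone hsome hG'
      have hsum := h.sum_nbrCount_comp fun d ↦ (d - 1) / 2
      refine h.exclReach_succ (ih (h.nbrCount_pos hpos (by omega) (by omega)) ?_ ?_)
      · refine hG'.imp_right (And.imp_right ?_)
        rintro ⟨v, hv⟩
        by_cases hvu : v = u
        · subst hvu
          refine ⟨some v, hsome ▸ ?_⟩
          rw [Nat.odd_iff] at hv ⊢
          omega
        · exact ⟨some v, (h.nbrCount_some hvu).symm ▸ hv⟩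
      · simp only [hnone, hsome] at hsum
        omega
    by_cases hac : G.IsAcyclic
    · obtain ⟨u, hu⟩ : ∃ u, 3 ≤ nbrCount G u := by
        by_contra! hlt
        have : ∑ v, (nbrCount G v - 1) / 2 = 0 :=
          Finset.sum_eq_zero fun v _ ↦ by have := hlt v; omega
        omega
      obtain ⟨A, hA, hcard⟩ := Set.exists_subset_card_eq (s := G.neighborSet u) (n := 2)
        (le_trans (by omega) hu)
      obtain ⟨G', h, -, -, hnone, hsome⟩ := exists_isExclusiveSplit_nbrCount hA
      exact hstep h hu (hnone.trans hcard) (hcard ▸ hsome) (.inl (h.isAcyclic hac))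
    · obtain ⟨hconn, o, ho⟩ := hG.resolve_left hac
      obtain ⟨u, a, b, hu, hab, ha, hb, p, hp⟩ := exists_branching_vertex_on_cycle hconn hac ho
      obtain ⟨c, hc, hcab⟩ : ∃ c ∈ G.neighborSet u, c ∉ ({a, b} : Set V) :=
        Set.exists_mem_notMem_of_ncard_lt_ncard
          (lt_of_lt_of_le (by rw [Set.ncard_pair hab]; omega) hu)
      simp only [Set.mem_insert_iff, Set.mem_singleton_iff, not_or] at hcab
      have hA : ({a, c} : Set V) ⊆ G.neighborSet u := by
        rintro x (rfl | rfl)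
        · exact ha
        · exact hc
      have hcard : ({a, c} : Set V).ncard = 2 := Set.ncard_pair (Ne.symm hcab.1)
      obtain ⟨G', h, hn', hs', hnone, hsome⟩ := exists_isExclusiveSplit_nbrCount hA
      refine hstep h hu (hnone.trans hcard) (hcard ▸ hsome) (.inr ⟨?_, o, ho⟩)
      refine h.connected hconn ((hn' a).mpr (.inl rfl)) ((hs' b).mpr ⟨hb, ?_⟩) p hp
      rintro (rfl | rfl)
      · exact hab rfl
      · exact hcab.2 rfl

/-- The upper bound for connected graphs all of whose degrees are even. -/
theorem exclReach_of_forall_even {V : Type} [Fintype V] {G : SimpleGraph V}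
    (hconn : G.Connected) (hpos : ∀ v, 0 < nbrCount G v) (heven : ∀ v, Even (nbrCount G v)) :
    ExclReach (fun _ H ↦ IsLinearForest H) (∑ v, (nbrCount G v - 1) / 2 + 1) V G := by
  have := hconn.nonempty
  have hcyc : ¬ G.IsAcyclic := by
    intro hac
    obtain ⟨v, hv⟩ := exists_nbrCount_eq_one hac hpos
    exact absurd (heven v) (hv ▸ by decide)
  obtain ⟨u, c, hc⟩ : ∃ (v : V) (c : G.Walk v v), c.IsCycle := by
    simpa [IsAcyclic] using hcyc
  obtain ⟨a, b, hab, ha, hb, p, hp⟩ := exists_walk_avoiding_of_isCycle hc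
  obtain ⟨G', h, hn, hs, hnone, hsome⟩ :=
    exists_isExclusiveSplit_nbrCount (Set.singleton_subset_iff.mpr ha)
  rw [Set.ncard_singleton] at hnone hsome
  have hu := hpos u
  have hu' := Nat.even_iff.mp (heven u)
  have hconn' := h.connected hconn ((hn a).mpr rfl) ((hs b).mpr ⟨hb, Ne.symm hab⟩) p hp
  have hreach := exclReach_sum_nbrCount_sub_one_div_two
    (h.nbrCount_pos hpos (by omega) (by omega)) (.inr ⟨hconn', none, hnone ▸ odd_one⟩)
  have hsum := h.sum_nbrCount_comp fun d ↦ (d - 1) / 2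
  simp only [hnone, hsome] at hsum
  have heq : ∑ p, (nbrCount G' p - 1) / 2 = ∑ v, (nbrCount G v - 1) / 2 := by omega
  exact h.exclReach_succ (heq ▸ hreach)

/-- Let `G` be a connected finite simple graph with at least one edge
and `α` its number of odd-degree vertices.  The minimum number of exclusive vertex
splits required to transform `G` into a linear forest equals
`|E(G)| - |V(G)| + max (α/2) 1`. -/
theorem minExclusiveSplits_linearForest {V : Type} [Fintype V] (G : SimpleGraph V)
    (hconn : G.Connected) (hE : G.edgeSet.Nonempty) :
    ((sInf {k : ℕ | ExclReach (fun _ H => IsLinearForest H) k V G} : ℕ) : ℤ)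
      = (G.edgeSet.ncard : ℤ) - (Fintype.card V : ℤ)
        + ((max ({v : V | Odd ((G.neighborSet v).ncard)}.ncard / 2) 1 : ℕ) : ℤ) := by
  have := hconn.nonempty
  have : Nontrivial V := by
    obtain ⟨⟨x, y⟩, hxy⟩ := hE
    exact ⟨x, y, G.ne_of_adj hxy⟩
  have hpos : ∀ v, 0 < nbrCount G v := fun v ↦
    nbrCount_pos_iff.mpr (hconn.preconnected.exists_adj_of_nontrivial v)
  set S := {k : ℕ | ExclReach (fun _ H => IsLinearForest H) k V G}
  set t := ∑ v, (nbrCount G v - 1) / 2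
  set o := ∑ v, nbrCount G v % 2
  have hodd : {v : V | Odd ((G.neighborSet v).ncard)}.ncard = o := (sum_nbrCount_mod_two G).symm
  have hsum : 2 * t + 2 * Fintype.card V = ∑ v, nbrCount G v + o :=
    two_mul_sum_nbrCount_sub_one_div_two hpos
  have hedge := sum_nbrCount G
  have hlow : ∀ k ∈ S, ∑ v, nbrCount G v + max o 2 ≤ 2 * Fintype.card V + 2 * k :=
    fun k hk ↦ ExclReach.sum_nbrCount_add_le hk
  obtain ⟨m, hm, hmax⟩ :
      ∃ m ∈ S, 2 * m + 2 * Fintype.card V = ∑ v, nbrCount G v + max o 2 := by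
    by_cases ho : ∃ v, Odd (nbrCount G v)
    · have htwo : 2 ≤ o := two_le_sum_nbrCount_mod_two ho.choose_spec
      exact ⟨t, exclReach_sum_nbrCount_sub_one_div_two hpos (.inr ⟨hconn, ho⟩), by omega⟩
    · simp only [not_exists, Nat.not_odd_iff_even] at ho
      have hzero : o = 0 := Finset.sum_eq_zero fun v _ ↦ Nat.even_iff.mp (ho v)
      exact ⟨t + 1, exclReach_of_forall_even hconn hpos ho, by omega⟩
  have hinf : sInf S = m := by
    refine le_antisymm (Nat.sInf_le hm) (le_csInf ⟨m, hm⟩ fun k hk ↦ ?_)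
    have := hlow k hk
    omega
  rw [hinf, hodd]
  omega
end

section
/- Let G be a finite simple graph and k a positive integer. Then G can be transformed into a bipartite graph by a sequence of at most k inclusive vertex splits if and only if there exists a set S of at most k vertices of G such that G − S is bipartite. -/
open SimpleGraph

/-- The map collapsing the two copies of `u` in an inclusive split back to `u`. -/
def splitProj {V : Type} (u : V) : Option V → V := fun a => a.getD u

/-- The inclusive split of `u` in which two vertices of `Option V` whose projections are
adjacent in `G` are joined whenever one of them lies in `T` or their colors differ. -/
def coloredSplit {V : Type} (G : SimpleGraph V) (u : V) (T : Finset (Option V))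
    (c : Option V → Bool) : SimpleGraph (Option V) where
  Adj a b := G.Adj (splitProj u a) (splitProj u b) ∧ (a ∈ T ∨ b ∈ T ∨ c a ≠ c b)
  symm := ⟨fun _ _ h => ⟨h.1.symm, by
    rcases h.2 with h | h | h
    exacts [Or.inr (Or.inl h), Or.inl h, Or.inr (Or.inr h.symm)]⟩⟩
  loopless := ⟨fun _ h => h.1.ne rfl⟩

theorem colorable_two_iff_exists_bool {W : Type} (G : SimpleGraph W) :
    G.Colorable 2 ↔ ∃ c : W → Bool, ∀ x y, G.Adj x y → c x ≠ c y := by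
  constructor
  · intro h
    let C : G.Coloring Bool := h.toColoring (by simp)
    exact ⟨C, fun x y hxy => C.valid hxy⟩
  · rintro ⟨c, hc⟩
    exact (Coloring.mk c fun {x y} hxy => hc x y hxy).colorable

theorem induce_compl_colorable_two_iff {V : Type} (G : SimpleGraph V) (S : Finset V) :
    (G.induce ((↑S : Set V)ᶜ)).Colorable 2 ↔
      ∃ c : V → Bool, ∀ x y, x ∉ S → y ∉ S → G.Adj x y → c x ≠ c y := by
  classical
  rw [colorable_two_iff_exists_bool]
  constructor
  · rintro ⟨c, hc⟩
    refine ⟨fun x => if h : x ∉ S then c ⟨x, by simpa using h⟩ else false, ?_⟩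
    intro x y hx hy hxy
    simp only [hx, hy, not_false_eq_true, dif_pos]
    exact hc _ _ hxy
  · rintro ⟨c, hc⟩
    exact ⟨fun x => c x, fun x y hxy => hc x y x.2 y.2 hxy⟩

theorem exists_transversal_of_inclReach (k : ℕ) {V : Type} (G : SimpleGraph V)
    (h : InclReach (fun _ H => H.Colorable 2) k V G) :
    ∃ S : Finset V, S.card ≤ k ∧
      ∃ c : V → Bool, ∀ x y, x ∉ S → y ∉ S → G.Adj x y → c x ≠ c y := by
  classical
  induction k generalizing V with
  | zero =>
    obtain ⟨c, hc⟩ := (colorable_two_iff_exists_bool G).1 h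
    exact ⟨∅, by simp, c, fun x y _ _ => hc x y⟩
  | succ k ih =>
    rcases h with h | ⟨u, G', hsplit, h⟩
    · obtain ⟨c, hc⟩ := (colorable_two_iff_exists_bool G).1 h
      exact ⟨∅, by simp, c, fun x y _ _ => hc x y⟩
    · obtain ⟨S, hS, c, hc⟩ := ih G' h
      refine ⟨insert u S.eraseNone, ?_, fun x => c (some x), ?_⟩
      · have h1 := Finset.card_insert_le u S.eraseNone
        have h2 : S.eraseNone.card ≤ S.card := by
          rw [← Finset.card_map Function.Embedding.some, Finset.map_some_eraseNone]
          exact Finset.card_erase_le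
        omega
      · intro x y hx hy hxy
        simp only [Finset.mem_insert, Finset.mem_eraseNone, not_or] at hx hy
        exact hc _ _ hx.2 hy.2 ((hsplit.1 x y hx.1 hy.1).2 hxy)

theorem isInclusiveSplit_coloredSplit {V : Type} (G : SimpleGraph V) (u : V)
    (T : Finset (Option V)) (c : Option V → Bool)
    (hG : ∀ x y, x ≠ u → y ≠ u → G.Adj x y →
      some x ∈ T ∨ some y ∈ T ∨ c (some x) ≠ c (some y))
    (hu : c (some u) ≠ c none) :
    IsInclusiveSplit G (coloredSplit G u T c) u := by
  refine ⟨fun x y hx hy => ⟨fun h => h.1, fun h => ⟨h, hG x y hx hy h⟩⟩,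
    fun h => h.1.ne rfl, fun x h => h.1, fun x h => h.1, fun x hx => ?_⟩
  by_cases hc : c (some u) = c (some x)
  · exact Or.inr ⟨hx, Or.inr (Or.inr fun h => hu (hc.trans h.symm))⟩
  · exact Or.inl ⟨hx, Or.inr (Or.inr hc)⟩

theorem inclReach_of_transversal (k : ℕ) {V : Type} (G : SimpleGraph V) (S : Finset V)
    (hS : S.card ≤ k) (c : V → Bool)
    (hc : ∀ x y, x ∉ S → y ∉ S → G.Adj x y → c x ≠ c y) :
    InclReach (fun _ H => H.Colorable 2) k V G := by
  classical
  induction k generalizing V with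
  | zero =>
    obtain rfl : S = ∅ := by simpa using hS
    exact (colorable_two_iff_exists_bool G).2 ⟨c, fun x y => hc x y (by simp) (by simp)⟩
  | succ k ih =>
    rcases S.eq_empty_or_nonempty with rfl | ⟨u, hu⟩
    · exact Or.inl ((colorable_two_iff_exists_bool G).2
        ⟨c, fun x y => hc x y (by simp) (by simp)⟩)
    · let T : Finset (Option V) := (S.erase u).map Function.Embedding.some
      let d : Option V → Bool := fun a => a.elim true (Function.update c u false)
      refine Or.inr ⟨u, coloredSplit G u T d, isInclusiveSplit_coloredSplit G u T d ?_ ?_,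
        ih _ T ?_ d ?_⟩
      · intro x y hx hy hxy
        have := hc x y
        simp only [T, d, Finset.mem_map, Finset.mem_erase, Function.Embedding.some_apply,
          Option.some.injEq, exists_eq_right, Option.elim_some, Function.update_of_ne hx,
          Function.update_of_ne hy]
        tauto
      · simp [d]
      · rw [Finset.card_map, Finset.card_erase_of_mem hu]
        omega
      · intro a b ha hb hab
        exact (hab.2.resolve_left ha).resolve_left hb

/-- Let `G` be a finite simple graph and `k` a positive integer.
Then `G` can be transformed into a bipartite graph by a sequence of at most `k`
inclusive vertex splits iff there is a set `S` of at most `k` vertices of `G` such that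
`G - S` is bipartite. -/
theorem bipartiteIVS_iff_oddCycleTransversal {V : Type} [Fintype V] (G : SimpleGraph V)
    (k : ℕ) (hk : 0 < k) :
    InclReach (fun _ H => H.Colorable 2) k V G ↔
      ∃ S : Finset V, S.card ≤ k ∧ (G.induce ((↑S : Set V)ᶜ)).Colorable 2 := by
  simp only [induce_compl_colorable_two_iff]
  exact ⟨exists_transversal_of_inclReach k G,
    fun ⟨S, hS, c, hc⟩ => inclReach_of_transversal k G S hS c hc⟩
end

section
/- Let G be a finite simple graph and k a positive integer. Then G can be transformed into a bipartite graph by a sequence of at most k exclusive vertex splits if and only if there exists a set S of at most k vertices of G such that G − S is bipartite. -/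
open SimpleGraph

/-- The split of `u` along a two-colouring `c` of the vertices: the copy `some u` receives the
neighbours of `u` coloured `true`, and the copy `none` those coloured `false`. -/
def colorSplit {V : Type} (G : SimpleGraph V) (u : V) (c : V → Bool) :
    SimpleGraph (Option V) where
  Adj
    | some x, some y => G.Adj x y ∧ (x = u → c y = true) ∧ (y = u → c x = true)
    | none, some y => G.Adj u y ∧ c y = false
    | some x, none => G.Adj u x ∧ c x = false
    | none, none => False
  symm := ⟨by
    rintro (_ | x) (_ | y) h
    · exact h
    · exact h
    · exact h
    · exact ⟨h.1.symm, h.2.2, h.2.1⟩⟩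
  loopless := ⟨by
    rintro (_ | x) h
    · exact h
    · exact G.loopless.irrefl x h.1⟩

theorem isExclusiveSplit_colorSplit {V : Type} (G : SimpleGraph V) (u : V) (c : V → Bool) :
    IsExclusiveSplit G (colorSplit G u c) u := by
  refine ⟨⟨fun x y hx hy => ?_, fun h => ?_, fun x h => h.1, fun x h => h.1, fun x h => ?_⟩,
    fun x h => ?_⟩
  · exact ⟨fun h => h.1, fun h => ⟨h, fun e => absurd e hx, fun e => absurd e hy⟩⟩
  · exact G.loopless.irrefl u h.1
  · cases hc : c x
    · exact Or.inr ⟨h, hc⟩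
    · exact Or.inl ⟨h, fun _ => hc, fun e => absurd e h.ne'⟩
  · have h₁ := h.1.2.1 rfl
    have h₂ := h.2.2
    simp [h₁] at h₂

/-- `G - S` is two-colourable iff some two-colouring of all of `G` is proper outside `S`. -/
theorem colorable_two_induce_compl_iff {V : Type} (G : SimpleGraph V) (S : Set V) :
    (G.induce Sᶜ).Colorable 2 ↔
      ∃ c : V → Bool, ∀ x y, G.Adj x y → x ∉ S → y ∉ S → c x ≠ c y := by
  classical
  constructor
  · rintro h
    obtain ⟨C⟩ : Nonempty ((G.induce Sᶜ).Coloring Bool) :=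
      ⟨h.toColoring (by simp)⟩
    refine ⟨fun x => if hx : x ∈ S then false else C ⟨x, hx⟩, fun x y hxy hx hy => ?_⟩
    simp only [hx, hy, dif_neg, not_false_eq_true]
    exact C.valid hxy
  · rintro ⟨c, hc⟩
    have C : (G.induce Sᶜ).Coloring Bool :=
      Coloring.mk (fun x => c x) fun {x y} h => hc x y h x.2 y.2
    simpa using C.colorable

theorem colorable_two_iff {V : Type} (G : SimpleGraph V) :
    G.Colorable 2 ↔ ∃ c : V → Bool, ∀ x y, G.Adj x y → c x ≠ c y := by
  constructor
  · rintro h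
    have C : G.Coloring Bool := h.toColoring (by simp)
    exact ⟨C, fun x y hxy => C.valid hxy⟩
  · rintro ⟨c, hc⟩
    have C : G.Coloring Bool := Coloring.mk c fun {x y} h => hc x y h
    simpa using C.colorable

theorem exists_transversal_of_exclReach (k : ℕ) : ∀ {V : Type} (G : SimpleGraph V),
    ExclReach (fun _ H => H.Colorable 2) k V G →
      ∃ S : Finset V, S.card ≤ k ∧
        ∃ c : V → Bool, ∀ x y, G.Adj x y → x ∉ S → y ∉ S → c x ≠ c y := by
  classical
  induction k with
  | zero =>
    intro V G h
    obtain ⟨c, hc⟩ := (colorable_two_iff G).1 h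
    exact ⟨∅, le_rfl, c, fun x y hxy _ _ => hc x y hxy⟩
  | succ k ih =>
    rintro V G (h | ⟨u, G', hsplit, h⟩)
    · obtain ⟨c, hc⟩ := (colorable_two_iff G).1 h
      exact ⟨∅, Nat.zero_le _, c, fun x y hxy _ _ => hc x y hxy⟩
    · obtain ⟨S, hS, c, hc⟩ := ih G' h
      refine ⟨insert u (S.image fun a => a.getD u), ?_, fun x => c (some x),
        fun x y hxy hx hy => ?_⟩
      · exact (Finset.card_insert_le _ _).trans
          (Nat.succ_le_succ (Finset.card_image_le.trans hS))
      · simp only [Finset.mem_insert, Finset.mem_image, not_or, not_exists, not_and] at hx hy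
        exact hc _ _ ((hsplit.1.1 x y hx.1 hy.1).2 hxy)
          (fun h => hx.2 _ h rfl) (fun h => hy.2 _ h rfl)

theorem exclReach_of_exists_transversal (k : ℕ) : ∀ {V : Type} (G : SimpleGraph V)
    (S : Finset V) (c : V → Bool), S.card ≤ k →
      (∀ x y, G.Adj x y → x ∉ S → y ∉ S → c x ≠ c y) →
        ExclReach (fun _ H => H.Colorable 2) k V G := by
  classical
  induction k with
  | zero =>
    intro V G S c hS hc
    obtain rfl : S = ∅ := by simpa using hS
    exact (colorable_two_iff G).2 ⟨c, fun x y h => hc x y h (by simp) (by simp)⟩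
  | succ k ih =>
    intro V G S c hS hc
    obtain rfl | ⟨u, hu⟩ := S.eq_empty_or_nonempty
    · exact Or.inl ((colorable_two_iff G).2 ⟨c, fun x y h => hc x y h (by simp) (by simp)⟩)
    · refine Or.inr ⟨u, colorSplit G u c, isExclusiveSplit_colorSplit G u c,
        ih _ ((S.erase u).image some) (fun a => a.elim true (Function.update c u false)) ?_ ?_⟩
      · have := Finset.card_erase_of_mem hu
        exact Finset.card_image_le.trans (by omega)
      · rintro (_ | x) (_ | y) h hx hy
        · exact h.elim
        · have hyu : y ≠ u := h.1.ne'
          simp [Function.update_of_ne hyu, h.2]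
        · have hxu : x ≠ u := h.1.ne'
          simp [Function.update_of_ne hxu, h.2]
        · obtain ⟨hxy, h₁, h₂⟩ := h
          have hne := hxy.ne
          have := hc x y hxy
          simp only [Finset.mem_image, Finset.mem_erase, Option.some.injEq, exists_eq_right,
            not_and] at hx hy
          simp only [Option.elim_some, Function.update_apply]
          grind

/-- Let `G` be a finite simple graph and `k` a positive integer.
Then `G` can be transformed into a bipartite graph by a sequence of at most `k`
exclusive vertex splits iff there is a set `S` of at most `k` vertices of `G` such that
`G - S` is bipartite. -/
theorem bipartiteEVS_iff_oddCycleTransversal {V : Type} [Fintype V] (G : SimpleGraph V)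
    (k : ℕ) (hk : 0 < k) :
    ExclReach (fun _ H => H.Colorable 2) k V G ↔
      ∃ S : Finset V, S.card ≤ k ∧ (G.induce ((↑S : Set V)ᶜ)).Colorable 2 := by
  simp only [colorable_two_induce_compl_iff, Finset.mem_coe]
  exact ⟨exists_transversal_of_exclReach k G,
    fun ⟨S, hS, c, hc⟩ => exclReach_of_exists_transversal k G S c hS hc⟩
end
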